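/- arXiv:1106.0369 — 3 statements merged into one kernel-verified Lean document; each statement's English description precedes it below -/
import Mathlib

section
/- For every finite union-closed family F of finite sets, the average set size satisfies (1/|F|) Σ_{A ∈ F} |A| ≥ (1/2) log₂ |F|. -/
/-- A finite family of finite sets is union-closed if it is closed under pairwise unions. -/
def UnionClosed (F : Finset (Finset ℕ)) : Prop :=
  ∀ A ∈ F, ∀ B ∈ F, A ∪ B ∈ F

def rstep (F : Finset (Finset ℕ)) (i : ℕ) (A : Finset ℕ) : Finset ℕ :=
  if insert i A ∈ F then A else insert i A

theorem rstep_cases (F : Finset (Finset ℕ)) (i : ℕ) (A : Finset ℕ) :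
    (insert i A ∈ F ∧ rstep F i A = A) ∨ (insert i A ∉ F ∧ rstep F i A = insert i A) := by
  unfold rstep
  split_ifs with h
  · exact Or.inl ⟨h, rfl⟩
  · exact Or.inr ⟨h, rfl⟩

theorem rstep_inj (F : Finset (Finset ℕ)) (i : ℕ) (A B : Finset ℕ) (hA : A ∈ F) (hB : B ∈ F)
    (h : rstep F i A = rstep F i B) : A = B := by
  rcases rstep_cases F i A with ⟨h1, h2⟩ | ⟨h1, h2⟩ <;>
  rcases rstep_cases F i B with ⟨h3, h4⟩ | ⟨h3, h4⟩ <;> rw [h2, h4] at h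
  · exact h
  · rw [← h] at h3; exact absurd hA h3
  · rw [h] at h1; exact absurd hB h1
  · have hiA : i ∉ A := fun hi => h1 (by rwa [Finset.insert_eq_of_mem hi])
    have hiB : i ∉ B := fun hi => h3 (by rwa [Finset.insert_eq_of_mem hi])
    rw [← Finset.erase_insert hiA, h, Finset.erase_insert hiB]

theorem mem_rstep (F : Finset (Finset ℕ)) (i : ℕ) (C : Finset ℕ) :
    C ∈ F.image (rstep F i) ↔ (C ∈ F ∧ insert i C ∈ F) ∨ (∃ A ∈ F, C = insert i A) := by
  rw [Finset.mem_image]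
  constructor
  · rintro ⟨A, hA, rfl⟩
    rcases rstep_cases F i A with ⟨h1, h2⟩ | ⟨h1, h2⟩ <;> rw [h2]
    · exact Or.inl ⟨hA, h1⟩
    · exact Or.inr ⟨A, hA, rfl⟩
  · rintro (⟨h1, h2⟩ | ⟨A, hA, rfl⟩)
    · exact ⟨C, h1, by simp [rstep, h2]⟩
    · by_cases h : insert i A ∈ F
      · exact ⟨insert i A, h, by simp [rstep, h]⟩
      · exact ⟨A, hA, by simp [rstep, h]⟩

theorem rstep_uc (F : Finset (Finset ℕ)) (i : ℕ) (hF : UnionClosed F) :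
    UnionClosed (F.image (rstep F i)) := by
  intro A hA B hB
  rw [mem_rstep] at *
  rcases hA with ⟨h1, h2⟩ | ⟨A', h1, rfl⟩ <;> rcases hB with ⟨h3, h4⟩ | ⟨B', h3, rfl⟩
  · left
    refine ⟨hF _ h1 _ h3, ?_⟩
    rw [← Finset.insert_union]; exact hF _ h2 _ h3
  · right
    exact ⟨A ∪ B', hF _ h1 _ h3, by ext; simp⟩
  · right
    exact ⟨A' ∪ B, hF _ h1 _ h3, by ext; simp⟩
  · right
    exact ⟨A' ∪ B', hF _ h1 _ h3, by ext; simp⟩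

theorem exists_phi (S : Finset ℕ) : ∀ F : Finset (Finset ℕ), UnionClosed F →
    ∃ φ : Finset ℕ → Finset ℕ, (∀ A ∈ F, A ⊆ φ A ∧ φ A ⊆ A ∪ S) ∧
      (∀ A ∈ F, ∀ B ∈ F, φ A = φ B → A = B) ∧
      (∀ A ∈ F, ∀ C ∈ F, A ⊆ C → C ⊆ φ A → C = A) ∧
      (∀ i ∈ S, ∀ A ∈ F, ∃ B ∈ F, φ B = insert i (φ A)) ∧
      (∀ i, (∀ A ∈ F, insert i A ∈ F) → ∀ A ∈ F, ∃ B ∈ F, φ B = insert i (φ A)) := by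
  induction S using Finset.induction_on with
  | empty =>
    intro F hF
    refine ⟨id, by simp, by simp, ?_, by simp, ?_⟩
    · intro A _ C _ h1 h2
      exact Finset.Subset.antisymm h2 h1
    · intro i h A hA
      exact ⟨_, h A hA, rfl⟩
  | insert i S hi ih =>
    intro F hF
    obtain ⟨ψ, p1, p2, p3, p4, p5⟩ := ih _ (rstep_uc F i hF)
    have hm : ∀ A ∈ F, rstep F i A ∈ F.image (rstep F i) := fun A hA =>
      Finset.mem_image_of_mem _ hA
    have hsub : ∀ A, A ⊆ rstep F i A := by
      intro A
      rcases rstep_cases F i A with ⟨h1, h2⟩ | ⟨h1, h2⟩ <;> rw [h2]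
      exact Finset.subset_insert _ _
    have hsub2 : ∀ A, rstep F i A ⊆ insert i A := by
      intro A
      rcases rstep_cases F i A with ⟨h1, h2⟩ | ⟨h1, h2⟩ <;> rw [h2]
      exact Finset.subset_insert _ _
    refine ⟨fun A => ψ (rstep F i A), ?_, ?_, ?_, ?_, ?_⟩
    · intro A hA
      obtain ⟨q1, q2⟩ := p1 _ (hm A hA)
      refine ⟨(hsub A).trans q1, fun x hx => ?_⟩
      have := q2 hx
      rw [Finset.mem_union] at this
      rcases this with h | h
      · have := hsub2 A h
        simp only [Finset.mem_insert, Finset.mem_union] at *; tauto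
      · simp only [Finset.mem_insert, Finset.mem_union] at *; tauto
    · intro A hA B hB h
      exact rstep_inj F i A B hA hB (p2 _ (hm A hA) _ (hm B hB) h)
    · intro A hA C hC hAC hC2
      obtain ⟨q1, q2⟩ := p1 _ (hm A hA)
      have key : C ∪ rstep F i A ∈ F.image (rstep F i) := by
        rw [mem_rstep]
        rcases rstep_cases F i A with ⟨h1, h2⟩ | ⟨h1, h2⟩ <;> rw [h2]
        · left
          rw [Finset.union_eq_left.2 hAC]
          refine ⟨hC, ?_⟩
          have := hF _ hC _ h1
          rwa [Finset.union_insert, Finset.union_eq_left.2 hAC] at this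
        · right
          exact ⟨C, hC, by rw [Finset.union_insert, Finset.union_eq_left.2 hAC]⟩
      have h3 := p3 _ (hm A hA) _ key Finset.subset_union_right (Finset.union_subset hC2 q1)
      have h4 : C ⊆ rstep F i A := by rw [← h3]; exact Finset.subset_union_left
      rcases rstep_cases F i A with ⟨h1, h2⟩ | ⟨h1, h2⟩ <;> rw [h2] at h4
      · exact Finset.Subset.antisymm h4 hAC
      · by_cases hiC : i ∈ C
        · exfalso
          apply h1
          have : insert i A = C := Finset.Subset.antisymm (Finset.insert_subset hiC hAC) h4
          rwa [this]
        · exact Finset.Subset.antisymm ((Finset.subset_insert_iff_of_notMem hiC).1 h4) hAC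
    · intro j hj A hA
      have : ∃ B ∈ F.image (rstep F i), ψ B = insert j (ψ (rstep F i A)) := by
        rcases Finset.mem_insert.1 hj with rfl | hj
        · apply p5 _ _ _ (hm A hA)
          intro B hB
          rw [mem_rstep] at *
          right
          rcases hB with ⟨h, _⟩ | ⟨B', h, rfl⟩
          · exact ⟨B, h, rfl⟩
          · exact ⟨B', h, by simp⟩
        · exact p4 j hj _ (hm A hA)
      obtain ⟨B, hB, h⟩ := this
      obtain ⟨B', hB', rfl⟩ := Finset.mem_image.1 hB
      exact ⟨B', hB', h⟩
    · intro j hj A hA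
      have : ∃ B ∈ F.image (rstep F i), ψ B = insert j (ψ (rstep F i A)) := by
        apply p5 _ _ _ (hm A hA)
        intro B hB
        rw [mem_rstep] at *
        rcases hB with ⟨h, h'⟩ | ⟨B', h, rfl⟩
        · left
          exact ⟨hj _ h, by rw [Finset.insert_comm]; exact hj _ h'⟩
        · right
          exact ⟨_, hj _ h, by rw [Finset.insert_comm]⟩
      obtain ⟨B, hB, h⟩ := this
      obtain ⟨B', hB', rfl⟩ := Finset.mem_image.1 hB
      exact ⟨B', hB', h⟩

theorem exists_phi2 (F : Finset (Finset ℕ)) (hF : UnionClosed F) :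
    ∃ (N : Finset ℕ) (φ : Finset ℕ → Finset ℕ), (∀ A ∈ F, A ⊆ φ A ∧ φ A ⊆ N) ∧
      (∀ A ∈ F, ∀ B ∈ F, φ A = φ B → A = B) ∧
      (∀ A ∈ F, ∀ B ∈ F, ∀ X, A ⊆ X → B ⊆ X → X ⊆ φ A → X ⊆ φ B → A = B) ∧
      (∀ i ∈ N, ∀ A ∈ F, ∃ B ∈ F, φ B = insert i (φ A)) := by
  obtain ⟨φ, p1, p2, p3, p4, -⟩ := exists_phi (F.biUnion id) F hF
  refine ⟨F.biUnion id, φ, ?_, p2, ?_, p4⟩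
  · intro A hA
    refine ⟨(p1 A hA).1, (p1 A hA).2.trans (Finset.union_subset ?_ subset_rfl)⟩
    exact Finset.subset_biUnion_of_mem id hA
  · intro A hA B hB X h1 h2 h3 h4
    have e1 := p3 A hA (A ∪ B) (hF _ hA _ hB) Finset.subset_union_left
      ((Finset.union_subset h1 h2).trans h3)
    have e2 := p3 B hB (A ∪ B) (hF _ hA _ hB) Finset.subset_union_right
      ((Finset.union_subset h1 h2).trans h4)
    rw [← e1, e2]

theorem reimer_count (F : Finset (Finset ℕ)) (N : Finset ℕ) (φ : Finset ℕ → Finset ℕ)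
    (p1 : ∀ A ∈ F, A ⊆ φ A ∧ φ A ⊆ N)
    (p2 : ∀ A ∈ F, ∀ B ∈ F, φ A = φ B → A = B)
    (p3 : ∀ A ∈ F, ∀ B ∈ F, ∀ X, A ⊆ X → B ⊆ X → X ⊆ φ A → X ⊆ φ B → A = B)
    (p4 : ∀ i ∈ N, ∀ A ∈ F, ∃ B ∈ F, φ B = insert i (φ A)) :
    ∑ A ∈ F, ((N \ φ A).card + (φ A \ A).card) ≤ ∑ A ∈ F, (φ A).card := by
  have dc : ∀ f : Finset ℕ → Finset ℕ, (∀ A ∈ F, f A ⊆ N) →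
      ∑ A ∈ F, (f A).card = ∑ i ∈ N, (F.filter (fun A => i ∈ f A)).card := by
    intro f hf
    refine Eq.trans ?_ (Finset.sum_card_bipartiteAbove_eq_sum_card_bipartiteBelow
      (s := F) (t := N) (fun A i => i ∈ f A))
    · apply Finset.sum_congr rfl
      intro A hA
      congr 1
      ext x
      simp only [Finset.bipartiteAbove, Finset.mem_filter]
      exact ⟨fun h => ⟨hf A hA h, h⟩, fun h => h.2⟩
  rw [Finset.sum_add_distrib, dc _ (fun A hA => (p1 A hA).2),
    dc (fun A => N \ φ A) (fun A hA => Finset.sdiff_subset),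
    dc (fun A => φ A \ A) (fun A hA => Finset.sdiff_subset.trans (p1 A hA).2),
    ← Finset.sum_add_distrib]
  apply Finset.sum_le_sum
  intro i hi
  have c1 : (F.filter (fun A => i ∈ N \ φ A)).card =
      ((F.filter (fun A => i ∈ N \ φ A)).image (fun A => insert i (φ A))).card := by
    rw [Finset.card_image_of_injOn]
    intro A hA B hB h
    simp only [Finset.coe_filter, Finset.mem_sdiff, Set.mem_ofPred_eq] at hA hB
    apply p2 A hA.1 B hB.1
    rw [← Finset.erase_insert hA.2.2, ← Finset.erase_insert hB.2.2]
    exact congrArg (fun s => Finset.erase s i) h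
  have c2 : (F.filter (fun A => i ∈ φ A \ A)).card =
      ((F.filter (fun A => i ∈ φ A \ A)).image φ).card := by
    rw [Finset.card_image_of_injOn]
    intro A hA B hB h
    simp only [Finset.coe_filter, Set.mem_ofPred_eq] at hA hB
    exact p2 A hA.1 B hB.1 h
  have c3 : (F.filter (fun A => i ∈ φ A)).card =
      ((F.filter (fun A => i ∈ φ A)).image φ).card := by
    rw [Finset.card_image_of_injOn]
    intro A hA B hB h
    simp only [Finset.coe_filter, Set.mem_ofPred_eq] at hA hB
    exact p2 A hA.1 B hB.1 h
  rw [c1, c2, c3, ← Finset.card_union_of_disjoint]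
  · apply Finset.card_le_card
    intro X hX
    simp only [Finset.mem_union, Finset.mem_image, Finset.mem_filter, Finset.mem_sdiff] at *
    rcases hX with ⟨A, ⟨hA, _⟩, rfl⟩ | ⟨A, ⟨hA, h, _⟩, rfl⟩
    · obtain ⟨B, hB, h⟩ := p4 i hi A hA
      exact ⟨B, ⟨hB, by simp [h]⟩, h⟩
    · exact ⟨A, ⟨hA, h⟩, rfl⟩
  · rw [Finset.disjoint_left]
    intro X hX hX'
    simp only [Finset.mem_image, Finset.mem_filter, Finset.mem_sdiff] at *
    obtain ⟨B, ⟨hB, _, h1⟩, rfl⟩ := hX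
    obtain ⟨A, ⟨hA, h2, h3⟩, h4⟩ := hX'
    have : A = B := by
      apply p3 A hA B hB (φ B) _ (p1 B hB).1 _ subset_rfl
      · have := (p1 A hA).1
        rw [h4] at this
        exact (Finset.subset_insert_iff_of_notMem h3).1 this
      · rw [h4]; exact Finset.subset_insert _ _
    subst this
    exact h1 h2

theorem reimer_pow (F : Finset (Finset ℕ)) (N : Finset ℕ) (φ : Finset ℕ → Finset ℕ)
    (p1 : ∀ A ∈ F, A ⊆ φ A ∧ φ A ⊆ N)
    (p3 : ∀ A ∈ F, ∀ B ∈ F, ∀ X, A ⊆ X → B ⊆ X → X ⊆ φ A → X ⊆ φ B → A = B) :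
    ∑ A ∈ F, 2 ^ (φ A \ A).card ≤ 2 ^ N.card := by
  have : ∑ A ∈ F, 2 ^ (φ A \ A).card = (F.biUnion (fun A => Finset.Icc A (φ A))).card := by
    rw [Finset.card_biUnion]
    · apply Finset.sum_congr rfl
      intro A hA
      rw [Finset.card_Icc_finset (p1 A hA).1, Finset.card_sdiff_of_subset (p1 A hA).1]
    · intro A hA B hB hne
      refine Finset.disjoint_left.2 ?_
      intro X h1 h2
      rw [Finset.mem_Icc] at h1 h2
      exact hne (p3 A hA B hB X h1.1 h2.1 h1.2 h2.2)
  rw [this, ← Finset.card_powerset]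
  apply Finset.card_le_card
  intro X hX
  rw [Finset.mem_biUnion] at hX
  obtain ⟨A, hA, h⟩ := hX
  rw [Finset.mem_Icc] at h
  exact Finset.mem_powerset.2 (h.2.trans (p1 A hA).2)

/-- Reimer's theorem: the average set size of a nonempty union-closed family `F`
is at least `(1/2)·log₂ |F|`. -/
theorem stmt_1 (F : Finset (Finset ℕ)) (hUC : UnionClosed F) (hne : F.Nonempty) :
    (∑ A ∈ F, (A.card : ℝ)) / (F.card : ℝ) ≥ (1 / 2) * Real.logb 2 (F.card : ℝ) := by
  obtain ⟨N, φ, p1, p2, p3, p4⟩ := exists_phi2 F hUC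
  have h1 := reimer_count F N φ p1 p2 p3 p4
  have h2 := reimer_pow F N φ p1 p3
  have hm : (0 : ℝ) < F.card := by exact_mod_cast hne.card_pos
  have hl2 : 0 < Real.log 2 := Real.log_pos (by norm_num)
  have h1' : ∑ A ∈ F, (((N \ φ A).card : ℝ) + (φ A \ A).card) ≤ ∑ A ∈ F, ((φ A).card : ℝ) := by
    exact_mod_cast h1
  have h2' : ∑ A ∈ F, (2 : ℝ) ^ (φ A \ A).card ≤ 2 ^ N.card := by exact_mod_cast h2
  have h3 : ∑ A ∈ F, (Real.log F.card + ((φ A \ A).card : ℝ) * Real.log 2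
      - N.card * Real.log 2) ≤ ∑ A ∈ F, ((F.card : ℝ) * 2 ^ (φ A \ A).card / 2 ^ N.card - 1) := by
    apply Finset.sum_le_sum
    intro A hA
    have := Real.log_le_sub_one_of_pos
      (x := (F.card : ℝ) * 2 ^ (φ A \ A).card / 2 ^ N.card) (by positivity)
    rwa [Real.log_div (by positivity) (by positivity), Real.log_mul hm.ne' (by positivity),
      Real.log_pow, Real.log_pow] at this
  have h4 : ∑ A ∈ F, ((F.card : ℝ) * 2 ^ (φ A \ A).card / 2 ^ N.card - 1) ≤ 0 := by
    rw [Finset.sum_sub_distrib, ← Finset.sum_div, ← Finset.mul_sum]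
    simp only [Finset.sum_const, nsmul_eq_mul, mul_one]
    rw [sub_nonpos, div_le_iff₀ (by positivity)]
    exact mul_le_mul_of_nonneg_left h2' hm.le
  have h5 := h3.trans h4
  rw [Finset.sum_sub_distrib, Finset.sum_add_distrib, ← Finset.sum_mul] at h5
  simp only [Finset.sum_const, nsmul_eq_mul] at h5
  have e1 : ∑ A ∈ F, ((N \ φ A).card : ℝ) = F.card * N.card - ∑ A ∈ F, ((φ A).card : ℝ) := by
    rw [← nsmul_eq_mul, ← Finset.sum_const, ← Finset.sum_sub_distrib]
    apply Finset.sum_congr rfl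
    intro A hA
    rw [Finset.cast_card_sdiff (p1 A hA).2]
  have e2 : ∑ A ∈ F, ((φ A \ A).card : ℝ)
      = ∑ A ∈ F, ((φ A).card : ℝ) - ∑ A ∈ F, (A.card : ℝ) := by
    rw [← Finset.sum_sub_distrib]
    apply Finset.sum_congr rfl
    intro A hA
    rw [Finset.cast_card_sdiff (p1 A hA).1]
  rw [Finset.sum_add_distrib, e1] at h1'
  set d := ∑ A ∈ F, ((φ A \ A).card : ℝ)
  set p := ∑ A ∈ F, ((φ A).card : ℝ)
  set s := ∑ A ∈ F, (A.card : ℝ)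
  rw [ge_iff_le, le_div_iff₀ hm, Real.logb]
  have h6 : Real.log F.card / Real.log 2 * F.card ≤ F.card * N.card - d := by
    rw [div_mul_eq_mul_div, div_le_iff₀ hl2]
    linarith
  linarith
end

section
/- For all natural numbers n ≥ 1, s_n ≥ log₂(n)/(2n); equivalently, every finite union-closed family F of finite sets with |⋃F| = n satisfies (1/(n|F|)) Σ_{A ∈ F} |A| ≥ log₂(n)/(2n). -/
/-- The density of a union-closed family `F`:
`D(F) = (1/(n·|F|)) · Σ_{A ∈ F} |A|` where `n = |⋃F|`. -/
noncomputable def density (F : Finset (Finset ℕ)) : ℝ :=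
  (∑ A ∈ F, (A.card : ℝ)) / (((F.sup id).card : ℝ) * (F.card : ℝ))

/-- `minDensity n` is the minimum density over all union-closed families whose
union has exactly `n` elements. -/
noncomputable def minDensity (n : ℕ) : ℝ :=
  sInf {d : ℝ | ∃ F : Finset (Finset ℕ),
    UnionClosed F ∧ (F.sup id).card = n ∧ d = density F}

/-- Up-shift of a single set in direction `i` relative to the family `G`. -/
def upS (i : ℕ) (G : Finset (Finset ℕ)) (A : Finset ℕ) : Finset ℕ :=
  if insert i A ∈ G then A else insert i A

lemma subset_upS (i : ℕ) (G : Finset (Finset ℕ)) (A : Finset ℕ) : A ⊆ upS i G A := by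
  unfold upS; split_ifs
  · exact Finset.Subset.refl _
  · exact Finset.subset_insert _ _

lemma upS_injOn (i : ℕ) (G : Finset (Finset ℕ)) : Set.InjOn (upS i G) (G : Set (Finset ℕ)) := by
  intro A hA B hB h
  have hA : A ∈ G := hA
  have hB : B ∈ G := hB
  unfold upS at h
  split_ifs at h with h1 h2 h2
  · exact h
  · subst h; exact absurd hA h2
  · subst h; exact absurd hB h1
  · by_cases iA : i ∈ A
    · rw [Finset.insert_eq_of_mem iA] at h1; exact absurd hA h1
    by_cases iB : i ∈ B
    · rw [Finset.insert_eq_of_mem iB] at h2; exact absurd hB h2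
    rw [← Finset.erase_insert iA, ← Finset.erase_insert iB, h]

lemma mem_upF (i : ℕ) (G : Finset (Finset ℕ)) (C : Finset ℕ) :
    C ∈ G.image (upS i G) ↔
      (C ∈ G ∧ insert i C ∈ G) ∨ (∃ A ∈ G, C = insert i A) := by
  constructor
  · intro h
    obtain ⟨A, hA, rfl⟩ := Finset.mem_image.1 h
    by_cases h1 : insert i A ∈ G
    · left; simp only [upS, if_pos h1]; exact ⟨hA, h1⟩
    · right; simp only [upS, if_neg h1]; exact ⟨A, hA, rfl⟩
  · rintro (⟨h1, h2⟩ | ⟨A, hA, rfl⟩)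
    · exact Finset.mem_image.2 ⟨C, h1, by simp [upS, h2]⟩
    · by_cases h1 : insert i A ∈ G
      · exact Finset.mem_image.2 ⟨insert i A, h1, by simp [upS, h1]⟩
      · exact Finset.mem_image.2 ⟨A, hA, by simp [upS, h1]⟩

lemma upF_unionClosed (i : ℕ) (G : Finset (Finset ℕ)) (hG : UnionClosed G) :
    UnionClosed (G.image (upS i G)) := by
  intro A hA B hB
  rw [mem_upF] at hA hB ⊢
  rcases hA with ⟨h1, h2⟩ | ⟨A', h1, rfl⟩ <;> rcases hB with ⟨h3, h4⟩ | ⟨B', h3, rfl⟩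
  · left
    refine ⟨hG _ h1 _ h3, ?_⟩
    rw [← Finset.insert_union]; exact hG _ h2 _ h3
  · right; exact ⟨A ∪ B', hG _ h1 _ h3, by rw [Finset.union_insert]⟩
  · right; exact ⟨A' ∪ B, hG _ h1 _ h3, by rw [Finset.insert_union]⟩
  · right; exact ⟨A' ∪ B', hG _ h1 _ h3, by ext; simp⟩

lemma upF_dir (i j : ℕ) (G : Finset (Finset ℕ)) (hG : ∀ C ∈ G, insert j C ∈ G) :
    ∀ C ∈ G.image (upS i G), insert j C ∈ G.image (upS i G) := by
  intro C hC
  rw [mem_upF] at hC ⊢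
  rcases hC with ⟨h1, h2⟩ | ⟨A', h1, rfl⟩
  · left; exact ⟨hG _ h1, by rw [Finset.insert_comm]; exact hG _ h2⟩
  · right; exact ⟨insert j A', hG _ h1, Finset.insert_comm _ _ _⟩

lemma upF_self (i : ℕ) (G : Finset (Finset ℕ)) :
    ∀ C ∈ G.image (upS i G), insert i C ∈ G.image (upS i G) := by
  intro C hC
  rw [mem_upF] at hC ⊢
  rcases hC with ⟨h1, h2⟩ | ⟨A', h1, rfl⟩
  · right; exact ⟨C, h1, rfl⟩
  · right; exact ⟨A', h1, by simp⟩

lemma reimer_map (l : List ℕ) : ∀ G : Finset (Finset ℕ), UnionClosed G →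
    ∃ f : Finset ℕ → Finset ℕ, Set.InjOn f (G : Set (Finset ℕ)) ∧
      (∀ j, (j ∈ l ∨ ∀ C ∈ G, insert j C ∈ G) → ∀ C ∈ G.image f, insert j C ∈ G.image f) ∧
      (∀ A, A ⊆ f A) ∧ (∀ A, f A ⊆ A ∪ l.toFinset) ∧
      (∀ A ∈ G, ∀ D, A ∪ D ∈ G → D ⊆ f A → D ⊆ A) := by
  induction l with
  | nil =>
    intro G _
    exact ⟨id, Set.injOn_id _, by simp, fun A => Finset.Subset.refl _, by simp,
      fun A _ D _ h => h⟩
  | cons i l ih =>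
    intro G hG
    obtain ⟨f, f1, f2, f3, f4, f5⟩ := ih _ (upF_unionClosed i G hG)
    refine ⟨f ∘ upS i G, ?_, ?_, ?_, ?_, ?_⟩
    · refine Set.InjOn.comp f1 (upS_injOn i G) ?_
      intro A hA
      exact Finset.mem_coe.2 (Finset.mem_image_of_mem _ hA)
    · intro j hj
      rw [← Finset.image_image]
      apply f2
      rcases hj with hj | hj
      · rcases List.mem_cons.1 hj with rfl | hj
        · right; exact upF_self _ _
        · left; exact hj
      · right; exact upF_dir _ _ _ hj
    · intro A; exact (subset_upS i G A).trans (f3 _)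
    · intro A
      refine (f4 _).trans ?_
      intro x hx
      simp only [upS, Finset.mem_union] at hx
      simp only [List.toFinset_cons, Finset.mem_union, Finset.mem_insert]
      split_ifs at hx
      · tauto
      · simp only [Finset.mem_insert] at hx; tauto
    · intro A hA D hAD hD
      by_cases h : insert i A ∈ G
      · have e : upS i G A = A := by simp [upS, h]
        have := f5 (upS i G A) (Finset.mem_image_of_mem _ hA) D (by
          rw [e, mem_upF]; left
          exact ⟨hAD, by rw [← Finset.insert_union]; convert hG _ h _ hAD using 1; ext; simp⟩) hD
        rwa [e] at this
      · have e : upS i G A = insert i A := by simp [upS, h]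
        have := f5 (upS i G A) (Finset.mem_image_of_mem _ hA) D (by
          rw [e, mem_upF]; right
          exact ⟨A ∪ D, hAD, by rw [Finset.insert_union]⟩) hD
        rw [e] at this
        by_cases iD : i ∈ D
        · exfalso; apply h
          convert hAD using 1
          ext x
          have := @this x
          simp only [Finset.mem_insert, Finset.mem_union] at *
          constructor
          · rintro (rfl | h)
            · exact Or.inr iD
            · exact Or.inl h
          · rintro (h | h)
            · exact Or.inr h
            · exact this h
        · intro x hx
          rcases Finset.mem_insert.1 (this hx) with rfl | h'
          · exact absurd hx iD
          · exact h'

lemma ent_ineq (a b : ℝ) (hb : 0 ≤ b) (hab : b ≤ a) :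
    a * Real.log a + b * Real.log b + 2 * b * Real.log 2 ≤ (a + b) * Real.log (a + b) := by
  rcases hb.eq_or_lt with rfl | hb
  · simp
  have ha : 0 < a := hb.trans_le hab
  have h1 : Real.log 2 + Real.log b ≤ Real.log (a + b) := by
    rw [← Real.log_mul (by norm_num) hb.ne']
    exact Real.log_le_log (by positivity) (by linarith)
  have h2 : b * Real.log 2 ≤ a * (Real.log (a + b) - Real.log a) := by
    have h3 := one_add_mul_self_le_rpow_one_add (s := b / a) (p := a / b)
      (by have : 0 ≤ b / a := by positivity
          linarith) (by rw [le_div_iff₀ hb]; linarith)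
    have h4 : a / b * (b / a) = 1 := by field_simp
    rw [h4] at h3
    have h5 := Real.log_le_log (by norm_num) h3
    rw [Real.log_rpow (by positivity)] at h5
    have h6 : 1 + b / a = (a + b) / a := by field_simp
    rw [h6, Real.log_div (by positivity) ha.ne', div_mul_eq_mul_div, le_div_iff₀ hb] at h5
    norm_num at h5
    linarith
  nlinarith

lemma lower_bound (S : Finset ℕ) : ∀ H : Finset (Finset ℕ), IsLowerSet (H : Set (Finset ℕ)) →
    (∀ C ∈ H, C ⊆ S) →
    2 * (∑ C ∈ H, (C.card : ℝ)) * Real.log 2 ≤ (H.card : ℝ) * Real.log H.card := by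
  induction S using Finset.induction_on with
  | empty =>
    intro H _ hS
    have : ∑ C ∈ H, (C.card : ℝ) = 0 := by
      apply Finset.sum_eq_zero
      intro C hC
      rw [Finset.subset_empty.1 (hS C hC)]; simp
    rw [this]
    have := Real.log_natCast_nonneg H.card
    simp only [mul_zero, zero_mul]
    positivity
  | insert a S _ ih =>
    intro H hH hS
    have i0 := ih (H.nonMemberSubfamily a) hH.nonMemberSubfamily (by
      intro C hC
      rw [Finset.mem_nonMemberSubfamily] at hC
      exact (Finset.subset_insert_iff_of_notMem hC.2).1 (hS C hC.1))
    have i1 := ih (H.memberSubfamily a) hH.memberSubfamily (by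
      intro C hC
      rw [Finset.mem_memberSubfamily] at hC
      have := hS _ hC.1
      exact (Finset.subset_insert_iff_of_notMem hC.2).1 ((Finset.subset_insert _ _).trans this))
    have hle : (H.memberSubfamily a).card ≤ (H.nonMemberSubfamily a).card :=
      Finset.card_le_card hH.memberSubfamily_subset_nonMemberSubfamily
    have hc := Finset.card_memberSubfamily_add_card_nonMemberSubfamily a H
    have hs : ∑ C ∈ H, (C.card : ℝ) = ∑ C ∈ H.nonMemberSubfamily a, (C.card : ℝ) +
        ∑ C ∈ H.memberSubfamily a, (C.card : ℝ) + (H.memberSubfamily a).card := by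
      rw [← Finset.sum_filter_add_sum_filter_not H (fun C => a ∈ C), add_comm, add_assoc]
      congr 1
      have : ∑ C ∈ H with a ∈ C, (C.card : ℝ) = ∑ C ∈ H.memberSubfamily a, ((C.card : ℝ) + 1) := by
        rw [Finset.memberSubfamily, Finset.sum_image]
        · apply Finset.sum_congr rfl
          intro C hC
          have := Finset.card_erase_add_one (Finset.mem_filter.1 hC).2
          exact_mod_cast this.symm
        · intro A hA B hB h
          have hA := (Finset.mem_filter.1 (Finset.mem_coe.1 hA)).2
          have hB := (Finset.mem_filter.1 (Finset.mem_coe.1 hB)).2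
          have h : A.erase a = B.erase a := h
          rw [← Finset.insert_erase hA, ← Finset.insert_erase hB, h]
      rw [this, Finset.sum_add_distrib]; simp
    have he := ent_ineq ((H.nonMemberSubfamily a).card : ℝ) ((H.memberSubfamily a).card : ℝ)
      (by positivity) (by exact_mod_cast hle)
    have hc' : (H.card : ℝ) = (H.nonMemberSubfamily a).card + (H.memberSubfamily a).card := by
      rw [← hc]; push_cast; ring
    rw [hs, hc']
    linarith

lemma reimer (F : Finset (Finset ℕ)) (hF : UnionClosed F) :
    (F.card : ℝ) * Real.log F.card ≤ 2 * (∑ A ∈ F, (A.card : ℝ)) * Real.log 2 := by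
  rcases F.eq_empty_or_nonempty with rfl | hne
  · simp
  set S := F.sup id with hS
  have hsub : ∀ A ∈ F, A ⊆ S := fun A hA => Finset.le_sup (f := id) hA
  obtain ⟨f, f1, f2, f3, f4, f5⟩ := reimer_map S.toList F hF
  have f4' : ∀ A ∈ F, f A ⊆ S := by
    intro A hA
    have := f4 A
    rw [Finset.toList_toFinset] at this
    exact this.trans (Finset.union_subset (hsub A hA) (Finset.Subset.refl _))
  -- disjoint intervals
  have hdisj : ∑ A ∈ F, (2 : ℝ) ^ ((f A).card - A.card) ≤ 2 ^ S.card := by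
    have h1 : (F.biUnion (fun A => Finset.Icc A (f A))).card ≤ S.powerset.card := by
      apply Finset.card_le_card
      intro C hC
      obtain ⟨A, hA, hC⟩ := Finset.mem_biUnion.1 hC
      exact Finset.mem_powerset.2 ((Finset.mem_Icc.1 hC).2.trans (f4' A hA))
    rw [Finset.card_biUnion, Finset.card_powerset] at h1
    · have : ∑ A ∈ F, 2 ^ ((f A).card - A.card) ≤ 2 ^ S.card := by
        refine le_trans (le_of_eq ?_) h1
        apply Finset.sum_congr rfl
        intro A _
        rw [Finset.card_Icc_finset (f3 A)]
      exact_mod_cast this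
    · intro A hA B hB hAB
      refine Finset.disjoint_left.2 ?_
      intro C hCA hCB
      rw [Finset.mem_Icc] at hCA hCB
      apply hAB
      apply Finset.Subset.antisymm
      · exact f5 B hB A (hF _ hB _ hA) (hCA.1.trans hCB.2)
      · exact f5 A hA B (hF _ hA _ hB) (hCB.1.trans hCA.2)
  -- Jensen
  have hm : (0 : ℝ) < F.card := by exact_mod_cast hne.card_pos
  have hJ : (∑ A ∈ F, (((f A).card : ℝ) - A.card)) * Real.log 2 ≤
      F.card * (S.card * Real.log 2 - Real.log F.card) := by
    have h1 : ∀ A ∈ F, (((f A).card : ℝ) - A.card) * Real.log 2 -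
        (S.card * Real.log 2 - Real.log F.card) + 1 ≤
        (2 : ℝ) ^ ((f A).card - A.card) * (F.card / 2 ^ S.card) := by
      intro A _
      refine (Real.add_one_le_exp _).trans (le_of_eq ?_)
      have e : ((f A).card : ℝ) - A.card = (((f A).card - A.card : ℕ) : ℝ) := by
        rw [Nat.cast_sub (Finset.card_le_card (f3 A))]
      rw [e, Real.exp_sub, Real.exp_sub, Real.exp_log hm, Real.exp_nat_mul, Real.exp_nat_mul,
        Real.exp_log (by norm_num)]
      field_simp
    have h2 := Finset.sum_le_sum h1
    rw [← Finset.sum_mul] at h2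
    have h3 : (∑ A ∈ F, (2 : ℝ) ^ ((f A).card - A.card)) * (F.card / 2 ^ S.card) ≤ F.card := by
      calc _ ≤ (2 : ℝ) ^ S.card * (F.card / 2 ^ S.card) := by gcongr
        _ = F.card := by field_simp
    have h4 := h2.trans h3
    rw [Finset.sum_add_distrib, Finset.sum_sub_distrib, ← Finset.sum_mul] at h4
    simp only [Finset.sum_const, nsmul_eq_mul, mul_one] at h4
    linarith
  -- upset
  have hup : ∀ C ∈ F.image f, ∀ D, D ⊆ S → C ∪ D ∈ F.image f := by
    intro C hC D
    induction D using Finset.induction_on with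
    | empty => intro _; simpa using hC
    | insert a D _ ih =>
      intro hD
      rw [Finset.union_insert]
      apply f2 a (Or.inl (by simpa using hD (Finset.mem_insert_self _ _)))
      exact ih ((Finset.subset_insert _ _).trans hD)
  have hinj : Set.InjOn (fun A => S \ f A) (F : Set (Finset ℕ)) := by
    intro A hA B hB h
    apply f1 hA hB
    have h : S \ f A = S \ f B := h
    rw [← Finset.sdiff_sdiff_eq_self (f4' A hA), h, Finset.sdiff_sdiff_eq_self (f4' B hB)]
  have hL := lower_bound S (F.image (fun A => S \ f A)) (by
    intro C D hDC hC
    obtain ⟨A, hA, rfl⟩ := Finset.mem_image.1 (Finset.mem_coe.1 hC)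
    have hDC : D ⊆ S \ f A := hDC
    have := hup (f A) (Finset.mem_image_of_mem _ hA) (S \ D) Finset.sdiff_subset
    obtain ⟨B, hB, hBe⟩ := Finset.mem_image.1 this
    refine Finset.mem_coe.2 (Finset.mem_image.2 ⟨B, hB, ?_⟩)
    rw [hBe]
    ext x
    have := @hDC x
    simp only [Finset.mem_sdiff, Finset.mem_union] at *
    tauto) (by
    intro C hC
    obtain ⟨A, hA, rfl⟩ := Finset.mem_image.1 hC
    exact Finset.sdiff_subset)
  rw [Finset.card_image_of_injOn hinj, Finset.sum_image hinj] at hL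
  have e : ∑ A ∈ F, ((S \ f A).card : ℝ) = ∑ A ∈ F, ((S.card : ℝ) - (f A).card) := by
    apply Finset.sum_congr rfl
    intro A hA
    rw [Finset.card_sdiff_of_subset (f4' A hA), Nat.cast_sub (Finset.card_le_card (f4' A hA))]
  rw [e] at hL
  rw [Finset.sum_sub_distrib] at hL hJ
  simp only [Finset.sum_const, nsmul_eq_mul] at hL hJ
  nlinarith

lemma main_log (F : Finset (Finset ℕ)) (hF : UnionClosed F) (hne : F.Nonempty)
    (hn : 1 ≤ (F.sup id).card) :
    (F.card : ℝ) * Real.log ((F.sup id).card) ≤ 2 * (∑ A ∈ F, (A.card : ℝ)) * Real.log 2 := by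
  have hm : (0 : ℝ) < F.card := by exact_mod_cast hne.card_pos
  have hclosed : ∀ T ⊆ F, T.Nonempty → T.sup id ∈ F := by
    intro T hT hTn
    rw [← Finset.sup'_eq_sup hTn]
    exact Finset.sup'_mem (F : Set (Finset ℕ)) (fun a ha b hb => hF a ha b hb) _ _ _
      (fun i hi => hT hi)
  set S := F.sup id with hS
  have hSF : S ∈ F := hclosed F (Finset.Subset.refl _) hne
  have hsub : ∀ A ∈ F, A ⊆ S := fun A hA => Finset.le_sup (f := id) hA
  have hnR : (0 : ℝ) < S.card := by exact_mod_cast hn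
  rcases le_or_gt S.card F.card with hle | hlt
  · refine le_trans ?_ (reimer F hF)
    gcongr
  let g : ℕ → Finset ℕ := fun x => (F.filter (fun A => x ∉ A)).sup id
  have hg : ∀ x, x ∉ g x := by
    intro x hx
    obtain ⟨A, hA, hxA⟩ := Finset.mem_sup.1 hx
    exact (Finset.mem_filter.1 hA).2 hxA
  have hgA : ∀ x, ∀ A ∈ F, x ∉ A → A ⊆ g x := by
    intro x A hA hx
    exact Finset.le_sup (f := id) (Finset.mem_filter.2 ⟨hA, hx⟩)
  have hgeq : ∀ x y, g x = g y → ∀ A ∈ F, x ∈ A → y ∈ A := by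
    intro x y h A hA hx
    by_contra hy
    apply hg x
    rw [h]
    exact hgA y A hA hy hx
  have hTsub : S.image g ⊆ insert ∅ (F.erase S) := by
    intro C hC
    obtain ⟨x, hx, rfl⟩ := Finset.mem_image.1 hC
    rcases (F.filter (fun A => x ∉ A)).eq_empty_or_nonempty with h | h
    · apply Finset.mem_insert.2; left
      simp only [g, h]; rfl
    · apply Finset.mem_insert.2; right
      refine Finset.mem_erase.2 ⟨?_, hclosed _ (Finset.filter_subset _ _) h⟩
      intro h'
      have := hg x
      apply this
      have h' : g x = S := h'
      rw [h']; exact hx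
  have hTcard : (S.image g).card ≤ F.card := by
    refine (Finset.card_le_card hTsub).trans ((Finset.card_insert_le _ _).trans ?_)
    rw [Finset.card_erase_add_one hSF]
  obtain ⟨R, hRS, hRi, hRc⟩ : ∃ R ⊆ S, (∀ x ∈ S, ∃ y ∈ R, g y = g x) ∧ R.card = (S.image g).card := by
    have : ∀ C ∈ S.image g, ∃ x ∈ S, g x = C := fun C hC => Finset.mem_image.1 hC
    choose! c hc1 hc2 using this
    refine ⟨(S.image g).image c, ?_, ?_, ?_⟩
    · intro x hx
      obtain ⟨C, hC, rfl⟩ := Finset.mem_image.1 hx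
      exact hc1 C hC
    · intro x hx
      have h := Finset.mem_image_of_mem g hx
      exact ⟨c (g x), Finset.mem_image_of_mem c h, hc2 _ h⟩
    · apply Finset.card_image_of_injOn
      intro C hC D hD h
      rw [← hc2 C hC, ← hc2 D hD, h]
  have hinj : Set.InjOn (fun A => A ∩ R) (F : Set (Finset ℕ)) := by
    have key : ∀ A ∈ F, ∀ B ∈ F, A ∩ R = B ∩ R → A ⊆ B := by
      intro A hA B hB h x hx
      obtain ⟨y, hy, hyx⟩ := hRi x (hsub A hA hx)
      have h1 := hgeq x y hyx.symm A hA hx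
      have h2 : y ∈ B ∩ R := by rw [← h]; exact Finset.mem_inter.2 ⟨h1, hy⟩
      exact hgeq y x hyx B hB (Finset.mem_inter.1 h2).1
    intro A hA B hB h
    exact Finset.Subset.antisymm (key A hA B hB h) (key B hB A hA h.symm)
  have hr := reimer (F.image (fun A => A ∩ R)) (by
    intro A hA B hB
    obtain ⟨A, hA2, rfl⟩ := Finset.mem_image.1 hA
    obtain ⟨B, hB2, rfl⟩ := Finset.mem_image.1 hB
    exact Finset.mem_image.2 ⟨A ∪ B, hF _ hA2 _ hB2, by simp [Finset.union_inter_distrib_right]⟩)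
  rw [Finset.card_image_of_injOn hinj, Finset.sum_image hinj] at hr
  have hsum : ∑ A ∈ F, ((A ∩ R).card : ℝ) + (S.card - F.card) ≤ ∑ A ∈ F, (A.card : ℝ) := by
    have h1 : ∑ A ∈ F, (A.card : ℝ) = ∑ A ∈ F, ((A ∩ R).card : ℝ) + ∑ A ∈ F, ((A \ R).card : ℝ) := by
      rw [← Finset.sum_add_distrib]
      apply Finset.sum_congr rfl
      intro A _
      exact_mod_cast (Finset.card_inter_add_card_sdiff A R).symm
    have h2 : ((S \ R).card : ℝ) ≤ ∑ A ∈ F, ((A \ R).card : ℝ) :=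
      Finset.single_le_sum (f := fun A => ((A \ R).card : ℝ)) (fun _ _ => by positivity) hSF
    rw [Finset.card_sdiff_of_subset hRS, Nat.cast_sub (Finset.card_le_card hRS)] at h2
    have h3 : (R.card : ℝ) ≤ F.card := by exact_mod_cast hRc.trans_le hTcard
    linarith
  have hlog : (F.card : ℝ) * (Real.log S.card - Real.log F.card) ≤ S.card - F.card := by
    rw [← Real.log_div hnR.ne' hm.ne']
    have := Real.log_le_sub_one_of_pos (div_pos hnR hm)
    calc _ ≤ (F.card : ℝ) * (S.card / F.card - 1) := by gcongr
      _ = _ := by field_simp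
  have hpos : (0 : ℝ) ≤ S.card - F.card := by
    have : (F.card : ℝ) ≤ S.card := by exact_mod_cast hlt.le
    linarith
  have hl2 : (0.69 : ℝ) < Real.log 2 := by have := Real.log_two_gt_d9; linarith
  nlinarith

/-- `s_n ≥ log₂ n / (2n)`; equivalently, every union-closed family `F` with
`|⋃F| = n` has density at least `log₂ n / (2n)`. -/
theorem stmt_5 (n : ℕ) (hn : 1 ≤ n) :
    minDensity n ≥ Real.logb 2 (n : ℝ) / (2 * (n : ℝ)) ∧
      ∀ F : Finset (Finset ℕ), UnionClosed F → (F.sup id).card = n →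
        (∑ A ∈ F, (A.card : ℝ)) / ((n : ℝ) * (F.card : ℝ)) ≥
          Real.logb 2 (n : ℝ) / (2 * (n : ℝ)) := by
  have key : ∀ F : Finset (Finset ℕ), UnionClosed F → (F.sup id).card = n →
        (∑ A ∈ F, (A.card : ℝ)) / ((n : ℝ) * (F.card : ℝ)) ≥
          Real.logb 2 (n : ℝ) / (2 * (n : ℝ)) := by
    intro F hF hc
    have hne : F.Nonempty := by
      rw [Finset.nonempty_iff_ne_empty]
      rintro rfl
      simp at hc
      omega
    have h := main_log F hF hne (by omega)
    rw [hc] at h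
    have hm : (0 : ℝ) < F.card := by exact_mod_cast hne.card_pos
    have hnR : (0 : ℝ) < n := by exact_mod_cast hn
    have hl2 : (0 : ℝ) < Real.log 2 := Real.log_pos (by norm_num)
    rw [ge_iff_le, Real.logb, div_div, div_le_div_iff₀ (by positivity) (by positivity)]
    nlinarith
  refine ⟨?_, key⟩
  apply le_csInf
  · exact ⟨_, {Finset.range n}, by intro A hA B hB; simp_all, by simp, rfl⟩
  · rintro d ⟨F, hF, hc, rfl⟩
    have := key F hF hc
    unfold density
    rw [hc]
    exact this
end

section
/- Let n ≥ 16 be a natural number and let F be a finite union-closed family of finite sets with |⋃F| = n. Then there exists a ∈ ⋃F such that |F_a| ≥ (1/2)·√(log₂(n)/n)·|F|. -/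
open Real Finset in
lemma kk_series {z : ℝ} (h0 : 0 < z) (h1 : z < 1) :
    HasSum (fun n : ℕ => z ^ (n+1) * (1 / ((n:ℝ)+1) - 1 / ((n:ℝ)+2)))
      (1 - (1 - z) * (-Real.log (1 - z)) / z) := by
  have ha := Real.hasSum_pow_div_log_of_abs_lt_one (x := z) (by rw [abs_of_pos h0]; exact h1)
  have hb := (hasSum_nat_add_iff' (f := fun n : ℕ => z ^ (n+1) / ((n:ℝ)+1)) 1).2 ha
  have hc := ha.sub (hb.div_const z)
  have e1 : (fun n : ℕ => z ^ (n+1) * (1 / ((n:ℝ)+1) - 1 / ((n:ℝ)+2))) =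
      fun b : ℕ => z ^ (b + 1) / ((b:ℝ) + 1) - z ^ (b + 1 + 1) / (((b + 1 : ℕ) : ℝ) + 1) / z := by
    funext n
    push_cast
    have : (n:ℝ)+1+1 ≠ 0 := by positivity
    have : (n:ℝ)+2 ≠ 0 := by positivity
    have : (n:ℝ)+1 ≠ 0 := by positivity
    field_simp
    ring
  have e2 : 1 - (1 - z) * (-Real.log (1 - z)) / z = -Real.log (1 - z) -
      (-Real.log (1 - z) - ∑ i ∈ Finset.range 1, z ^ (i + 1) / ((i:ℝ) + 1)) / z := by
    simp
    field_simp
    ring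
  rw [e1, e2]
  exact hc

lemma kk_concave {w x y : ℝ} (hx : 0 < x) (hx1 : x < 1) (hy : 0 < y) (hy1 : y < 1)
    (hw : 0 < w) (hw1 : w < 1) (hxy : w * w = x * y) :
    (1 - x) * (-Real.log (1 - x)) / x + (1 - y) * (-Real.log (1 - y)) / y
      ≤ 2 * ((1 - w) * (-Real.log (1 - w)) / w) := by
  have h := hasSum_le (f := fun n : ℕ => 2 * (w ^ (n+1) * (1 / ((n:ℝ)+1) - 1 / ((n:ℝ)+2))))
    ?_ ((kk_series hw hw1).mul_left 2) ((kk_series hx hx1).add (kk_series hy hy1))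
  · linarith
  · intro n
    have h1 : 0 ≤ (1 / ((n:ℝ)+1) - 1 / ((n:ℝ)+2)) := by
      rw [sub_nonneg]
      apply one_div_le_one_div_of_le <;> linarith [Nat.cast_nonneg (α := ℝ) n]
    have h2 : 2 * w ^ (n+1) ≤ x ^ (n+1) + y ^ (n+1) := by
      have e : w ^ (n+1) * w ^ (n+1) = x ^ (n+1) * y ^ (n+1) := by
        rw [← mul_pow, ← mul_pow, hxy]
      have p1 := pow_pos hx (n+1)
      have p2 := pow_pos hy (n+1)
      have p3 := pow_pos hw (n+1)
      refine abs_le_of_sq_le_sq' ?_ (by positivity) |>.2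
      nlinarith [sq_nonneg (x ^ (n+1) - y ^ (n+1))]
    nlinarith

lemma one_var {w : ℝ} (hw : 0 < w) (hw1 : w < 1) :
    (1 + w) * Real.log (1 + w) ≤
      0.6 * w^2 * (-Real.log w) / (1 - w) + (1 - 0.4 * w) * (-Real.log (1 - w)) := by
  have hL : (1 - w) + (1-w)^2/2 ≤ -Real.log w := by
    have := Real.hasSum_pow_div_log_of_abs_lt_one (x := 1 - w)
      (by rw [abs_of_pos (by linarith)]; linarith)
    have h := sum_le_hasSum (Finset.range 2) (fun i _ => by
      have : 0 < 1 - w := by linarith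
      positivity) this
    simp [Finset.sum_range_succ] at h
    norm_num at h
    linarith
  have hl : w + w^2/2 + w^3/3 ≤ -Real.log (1-w) := by
    have := Real.hasSum_pow_div_log_of_abs_lt_one (x := w)
      (by rw [abs_of_pos (by linarith)]; linarith)
    have h := sum_le_hasSum (Finset.range 3) (fun i _ => by positivity) this
    simp [Finset.sum_range_succ] at h
    norm_num at h
    linarith
  have hM : Real.log (1+w) ≤ w - w^2/2 + w^3/3 := by
    have hd : MonotoneOn (fun w : ℝ => w - w^2/2 + w^3/3 - Real.log (1+w)) (Set.Ici 0) := by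
      have hder : ∀ x : ℝ, 0 ≤ x → HasDerivAt (fun w : ℝ => w - w^2/2 + w^3/3 - Real.log (1+w))
          (1 - x + x^2 - 1/(1+x)) x := by
        intro x hx
        have h1 := ((hasDerivAt_id x).sub ((hasDerivAt_pow 2 x).div_const 2)).add
          ((hasDerivAt_pow 3 x).div_const 3)
        have h2 := ((hasDerivAt_id x).const_add 1).log (by simp; positivity)
        refine (h1.sub h2).congr_deriv ?_
        norm_num
      apply monotoneOn_of_deriv_nonneg (convex_Ici 0)
      · intro x hx
        exact (hder x hx).continuousAt.continuousWithinAt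
      · intro x hx
        rw [interior_Ici] at hx
        exact (hder x (le_of_lt hx)).differentiableAt.differentiableWithinAt
      · intro x hx
        rw [interior_Ici] at hx
        have hx0 : 0 < x := hx
        rw [(hder x hx0.le).deriv]
        rw [sub_nonneg, div_le_iff₀ (by linarith)]
        have : 0 < x^3 := by positivity
        nlinarith
    have := hd (a := 0) (b := w) (by simp) (by simpa using hw.le) hw.le
    simp at this
    linarith
  have hpos : 0 < 1 - w := by linarith
  have h1 : 0.6 * w^2 * (1 + (1-w)/2) ≤ 0.6 * w^2 * (-Real.log w) / (1 - w) := by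
    rw [le_div_iff₀ hpos]
    have : 0 < w^2 := by positivity
    nlinarith
  have h2 : (1 - 0.4 * w) * (w + w^2/2 + w^3/3) ≤ (1 - 0.4 * w) * (-Real.log (1 - w)) :=
    mul_le_mul_of_nonneg_left hl (by linarith)
  have h3 : (1+w) * Real.log (1+w) ≤ (1+w) * (w - w^2/2 + w^3/3) :=
    mul_le_mul_of_nonneg_left hM (by linarith)
  have h4 : w^4 ≤ w^2 := pow_le_pow_of_le_one hw.le hw1.le (by norm_num)
  have h5 : 0 < w^2 := by positivity
  nlinarith

lemma h_expand {x : ℝ} (hx : 0 < x) :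
    Real.binEntropy x = x * (-Real.log x + (1 - x) * (-Real.log (1 - x)) / x) := by
  rw [Real.binEntropy_eq_negMulLog_add_negMulLog_one_sub]
  simp only [Real.negMulLog]
  field_simp

lemma h_key {x y : ℝ} (hx : 0 ≤ x) (hx1 : x ≤ 1) (hy : 0 ≤ y) (hy1 : y ≤ 1) :
    0.7 * (x * Real.binEntropy y + y * Real.binEntropy x) ≤ Real.binEntropy (x * y) := by
  rcases hx.eq_or_lt with rfl | hx
  · simp
  rcases hy.eq_or_lt with rfl | hy
  · simp
  rcases hx1.eq_or_lt with rfl | hx1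
  · simp
    nlinarith [Real.binEntropy_nonneg hy.le hy1]
  rcases hy1.eq_or_lt with rfl | hy1
  · simp
    nlinarith [Real.binEntropy_nonneg hx.le hx1.le]
  set w := Real.sqrt (x * y) with hwdef
  have hxy : 0 < x * y := by positivity
  have hw : 0 < w := Real.sqrt_pos.2 hxy
  have hww : w * w = x * y := Real.mul_self_sqrt hxy.le
  have hw1 : w < 1 := by nlinarith
  have h1 := kk_concave hx hx1 hy hy1 hw hw1 hww
  have h2 := one_var hw hw1
  rw [h_expand hx, h_expand hy, h_expand hxy]
  have hlog : Real.log x + Real.log y = 2 * Real.log w := by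
    rw [← Real.log_mul hx.ne' hy.ne', ← hww, Real.log_mul hw.ne' hw.ne']; ring
  have hlog1 : Real.log (x * y) = 2 * Real.log w := by
    rw [← hww, Real.log_mul hw.ne' hw.ne']; ring
  have hlog2 : Real.log (1 - x * y) = Real.log (1 - w) + Real.log (1 + w) := by
    rw [← hww, ← Real.log_mul (by linarith) (by linarith)]; ring_nf
  have hpos : 0 < 1 - w := by linarith
  have h3 : 1.4 * ((1 - w) * (-Real.log (1 - w)) / w) ≤ 0.6 * (-Real.log w) +
      (1 - x * y) * (-Real.log (1 - x * y)) / (x * y) := by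
    rw [hlog2, ← hww]
    have h4 := mul_le_mul_of_nonneg_left h2 (show 0 ≤ (1 - w) / w^2 by positivity)
    have e1 : (1 - w) / w^2 * (0.6 * w^2 * (-Real.log w) / (1 - w) +
        (1 - 0.4 * w) * (-Real.log (1 - w))) =
        0.6 * (-Real.log w) + (1 - w) / w^2 * ((1 - 0.4 * w) * (-Real.log (1 - w))) := by
      field_simp
    rw [e1] at h4
    have e2 : (1 - w * w) * (-(Real.log (1 - w) + Real.log (1 + w))) / (w * w)
       - 1.4 * ((1 - w) * (-Real.log (1 - w)) / w) =
       (1 - w) / w^2 * ((1 - 0.4 * w) * (-Real.log (1 - w)))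
        - (1 - w) / w^2 * ((1 + w) * Real.log (1 + w)) := by
      field_simp
      ring
    linarith
  have h5 : 0.7 * ((-Real.log x + (1 - x) * (-Real.log (1 - x)) / x) +
      (-Real.log y + (1 - y) * (-Real.log (1 - y)) / y)) ≤
      -Real.log (x * y) + (1 - x * y) * (-Real.log (1 - x * y)) / (x * y) := by
    rw [hlog1]
    linarith
  have := mul_le_mul_of_nonneg_left h5 hxy.le
  linarith

noncomputable def gg (u v : ℝ) : ℝ :=
  Real.negMulLog u + Real.negMulLog v - Real.negMulLog (u + v)

lemma gg_hom (t x : ℝ) : gg (t * x) (t * (1 - x)) = t * Real.binEntropy x := by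
  unfold gg
  rw [← mul_add, Real.binEntropy_eq_negMulLog_add_negMulLog_one_sub]
  simp only [Real.negMulLog_mul]
  simp
  ring

lemma gg_zero : gg 0 0 = 0 := by simp [gg]

lemma par {u v : ℝ} (hu : 0 ≤ u) (hv : 0 ≤ v) :
    ∃ t x : ℝ, 0 ≤ t ∧ 0 ≤ x ∧ x ≤ 1 ∧ u = t * x ∧ v = t * (1 - x) := by
  by_cases h : u + v = 0
  · exact ⟨0, 0, le_rfl, le_rfl, zero_le_one, by linarith, by linarith⟩
  · have : 0 < u + v := lt_of_le_of_ne (by positivity) (Ne.symm h)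
    refine ⟨u + v, u / (u+v), this.le, by positivity, ?_, ?_, ?_⟩
    · rw [div_le_one this]; linarith
    · field_simp
    · field_simp; ring

lemma gg_nonneg {u v : ℝ} (hu : 0 ≤ u) (hv : 0 ≤ v) : 0 ≤ gg u v := by
  obtain ⟨t, x, ht, hx, hx1, rfl, rfl⟩ := par hu hv
  rw [gg_hom]
  exact mul_nonneg ht (Real.binEntropy_nonneg hx hx1)

lemma gg_add {u v u' v' : ℝ} (hu : 0 ≤ u) (hv : 0 ≤ v) (hu' : 0 ≤ u') (hv' : 0 ≤ v') :
    gg u v + gg u' v' ≤ gg (u + u') (v + v') := by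
  obtain ⟨t, x, ht, hx, hx1, rfl, rfl⟩ := par hu hv
  obtain ⟨s, y, hs, hy, hy1, rfl, rfl⟩ := par hu' hv'
  rcases (add_nonneg ht hs).eq_or_lt with h | h
  · have h1 : t = 0 := by linarith
    have h2 : s = 0 := by linarith
    subst h1 h2
    simp [gg_zero]
  have hc := Real.strictConcave_binEntropy.concaveOn.2 
    (Set.mem_Icc.2 ⟨hx, hx1⟩) (Set.mem_Icc.2 ⟨hy, hy1⟩)
    (show 0 ≤ t/(t+s) by positivity) (show 0 ≤ s/(t+s) by positivity) (by field_simp)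
  have e : t * x + s * y = (t + s) * (t/(t+s) * x + s/(t+s) * y) := by field_simp
  have e' : t * (1 - x) + s * (1 - y) = (t + s) * (1 - (t/(t+s) * x + s/(t+s) * y)) := by
    field_simp; ring
  rw [e, e', gg_hom, gg_hom, gg_hom]
  have := mul_le_mul_of_nonneg_left hc h.le
  simp only [smul_eq_mul] at this
  calc _ = (t+s) * (t/(t+s) * Real.binEntropy x + s/(t+s) * Real.binEntropy y) := by field_simp
    _ ≤ _ := this

lemma gg_sum {ι : Type*} (S : Finset ι) (u v : ι → ℝ) (hu : ∀ i, 0 ≤ u i) (hv : ∀ i, 0 ≤ v i) :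
    ∑ i ∈ S, gg (u i) (v i) ≤ gg (∑ i ∈ S, u i) (∑ i ∈ S, v i) := by
  classical
  induction S using Finset.induction_on with
  | empty => simp [gg_zero]
  | insert a S ha ih =>
    rw [Finset.sum_insert ha, Finset.sum_insert ha, Finset.sum_insert ha]
    have := gg_add (hu a) (hv a) (Finset.sum_nonneg (s := S) fun i _ => hu i)
      (Finset.sum_nonneg (s := S) fun i _ => hv i)
    linarith

lemma gg_key {u v u' v' : ℝ} (hu : 0 ≤ u) (hv : 0 ≤ v) (hu' : 0 ≤ u') (hv' : 0 ≤ v') :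
    0.7 * (u * gg u' v' + u' * gg u v) ≤ gg (u * u') (u * v' + v * u' + v * v') := by
  obtain ⟨t, x, ht, hx, hx1, rfl, rfl⟩ := par hu hv
  obtain ⟨s, y, hs, hy, hy1, rfl, rfl⟩ := par hu' hv'
  have e : t * x * (s * y) = (t * s) * (x * y) := by ring
  have e' : t * x * (s * (1 - y)) + t * (1 - x) * (s * y) + t * (1 - x) * (s * (1 - y)) =
    (t * s) * (1 - x * y) := by ring
  rw [e, e', gg_hom, gg_hom, gg_hom]
  have := mul_le_mul_of_nonneg_left (h_key hx hx1 hy hy1) (mul_nonneg ht hs)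
  linarith

lemma pow_bd (n : ℕ) (hn : 16 ≤ n) : n ^ 4 ≤ 2 ^ n := by
  induction n, hn using Nat.le_induction with
  | base => norm_num
  | succ n hn ih =>
    have : (n+1)^4 ≤ 2 * n^4 := by
      have h1 : 16 * n^3 ≤ n^4 := by rw [pow_succ n 3, mul_comm]; gcongr
      have h2 : 16 * n^2 ≤ n^3 := by rw [pow_succ n 2, mul_comm]; gcongr
      have h3 : 16 * n ≤ n^2 := by rw [pow_two]; gcongr
      nlinarith
    rw [pow_succ 2 n]; linarith

lemma bound_bd (n : ℕ) (hn : 16 ≤ n) :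
    (1 / 2) * Real.sqrt (Real.logb 2 (n : ℝ) / (n : ℝ)) ≤ 1 / 4 := by
  have hn0 : (0:ℝ) < n := by exact_mod_cast (by omega : 0 < n)
  have h1 : Real.logb 2 n ≤ n / 4 := by
    have h : (n:ℝ)^4 ≤ 2^n := by exact_mod_cast pow_bd n hn
    have h2 := Real.logb_le_logb_of_le (b := 2) (by norm_num) (by positivity) h
    rw [Real.logb_pow, Real.logb_pow, Real.logb_self_eq_one (by norm_num)] at h2
    push_cast at h2
    linarith
  have h2 : Real.sqrt (Real.logb 2 n / n) ≤ 1/2 := by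
    rw [Real.sqrt_le_left (by norm_num), div_le_iff₀ hn0]
    linarith
  linarith

/-- union convolution of m on subsets of G -/
noncomputable def ww (m : Finset ℕ → ℝ) (G s : Finset ℕ) : ℝ :=
  ∑ a ∈ G.powerset, ∑ b ∈ G.powerset, if a ∪ b = s then m a * m b else 0

lemma ww_total (m : Finset ℕ → ℝ) (G : Finset ℕ) :
    ∑ s ∈ G.powerset, ww m G s = (∑ a ∈ G.powerset, m a) * (∑ a ∈ G.powerset, m a) := by
  unfold ww
  rw [Finset.sum_comm, Finset.sum_mul_sum]
  refine Finset.sum_congr rfl fun a ha => ?_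
  rw [Finset.sum_comm]
  refine Finset.sum_congr rfl fun b hb => ?_
  rw [Finset.sum_ite_eq, if_pos]
  rw [Finset.mem_powerset] at *
  exact Finset.union_subset ha hb

lemma ww_nonneg (m : Finset ℕ → ℝ) (hm : ∀ a, 0 ≤ m a) (G s : Finset ℕ) : 0 ≤ ww m G s := by
  unfold ww
  refine Finset.sum_nonneg fun a _ => Finset.sum_nonneg fun b _ => ?_
  split_ifs
  · exact mul_nonneg (hm a) (hm b)
  · exact le_rfl

lemma ww_succ0 (m : Finset ℕ → ℝ) (G : Finset ℕ) (i : ℕ) (hi : i ∉ G) (s : Finset ℕ) (hs : s ⊆ G) :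
    ww m (insert i G) s = ∑ a ∈ G.powerset, ∑ b ∈ G.powerset,
      if a ∪ b = s then m a * m b else 0 := by
  unfold ww
  have his : i ∉ s := fun h => hi (hs h)
  simp only [Finset.sum_powerset_insert hi]
  have h1 : ∀ a b, insert i a ∪ b ≠ s := fun a b h => his (h ▸ by simp)
  have h2 : ∀ a b, a ∪ insert i b ≠ s := fun a b h => his (h ▸ by simp)
  simp only [h1, h2, if_false, Finset.sum_const_zero, add_zero]

lemma ww_succ1 (m : Finset ℕ → ℝ) (G : Finset ℕ) (i : ℕ) (hi : i ∉ G) (s : Finset ℕ) (hs : s ⊆ G) :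
    ww m (insert i G) (insert i s) = ∑ a ∈ G.powerset, ∑ b ∈ G.powerset,
      if a ∪ b = s then m a * m (insert i b) + m (insert i a) * m b
        + m (insert i a) * m (insert i b) else 0 := by
  unfold ww
  have his : i ∉ s := fun h => hi (hs h)
  simp only [Finset.sum_powerset_insert hi]
  rw [← Finset.sum_add_distrib]
  refine Finset.sum_congr rfl fun a ha => ?_
  rw [← Finset.sum_add_distrib, ← Finset.sum_add_distrib, ← Finset.sum_add_distrib]
  refine Finset.sum_congr rfl fun b hb => ?_
  rw [Finset.mem_powerset] at ha hb
  have hab : i ∉ a ∪ b := fun h => hi (Finset.union_subset ha hb h)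
  have h0 : a ∪ b ≠ insert i s := fun h => hab (h ▸ by simp)
  have key : insert i (a ∪ b) = insert i s ↔ a ∪ b = s := by
    constructor
    · intro h
      rw [← Finset.erase_insert hab, h, Finset.erase_insert his]
    · intro h; rw [h]
  have h1 : insert i a ∪ b = insert i s ↔ a ∪ b = s := by
    rw [Finset.insert_union]; exact key
  have h2 : a ∪ insert i b = insert i s ↔ a ∪ b = s := by
    rw [Finset.union_insert]; exact key
  have h3 : insert i a ∪ insert i b = insert i s ↔ a ∪ b = s := by
    rw [Finset.insert_union, Finset.union_insert, Finset.insert_idem]; exact key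
  simp only [h0, h1, h2, h3, if_false]
  split_ifs <;> ring

noncomputable def EE (m : Finset ℕ → ℝ) (G : Finset ℕ) : ℝ := ∑ s ∈ G.powerset, Real.negMulLog (m s)

lemma EE_diff (m m' : Finset ℕ → ℝ) (G : Finset ℕ) (i : ℕ) (hi : i ∉ G)
    (h : ∀ s ⊆ G, m s = m' s + m' (insert i s)) :
    EE m' (insert i G) - EE m G = ∑ s ∈ G.powerset, gg (m' s) (m' (insert i s)) := by
  unfold EE gg
  rw [Finset.sum_powerset_insert hi, Finset.sum_sub_distrib, Finset.sum_add_distrib]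
  congr 1
  refine Finset.sum_congr rfl fun s hs => ?_
  rw [h s (Finset.mem_powerset.1 hs)]

lemma step (m m' : Finset ℕ → ℝ) (G : Finset ℕ) (i : ℕ) (hi : i ∉ G)
    (hm : ∀ a, 0 ≤ m' a)
    (h : ∀ s ⊆ G, m s = m' s + m' (insert i s)) (q : ℝ) (hq : q ≤ ∑ s ∈ G.powerset, m' s) :
    1.4 * q * (EE m' (insert i G) - EE m G) ≤
      EE (ww m' (insert i G)) (insert i G) - EE (ww m G) G := by
  rw [EE_diff m m' G i hi h, EE_diff (ww m G) (ww m' (insert i G)) G i hi]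
  swap
  · intro s hs
    rw [ww_succ0 _ _ _ hi _ hs, ww_succ1 _ _ _ hi _ hs, ← Finset.sum_add_distrib]
    unfold ww
    refine Finset.sum_congr rfl fun a ha => ?_
    rw [← Finset.sum_add_distrib]
    refine Finset.sum_congr rfl fun b hb => ?_
    rw [Finset.mem_powerset] at ha hb
    rw [h a ha, h b hb]
    split_ifs <;> ring
  have hD : 0 ≤ ∑ s ∈ G.powerset, gg (m' s) (m' (insert i s)) :=
    Finset.sum_nonneg fun s _ => gg_nonneg (hm _) (hm _)
  calc _ ≤ 1.4 * (∑ s ∈ G.powerset, m' s) * ∑ s ∈ G.powerset, gg (m' s) (m' (insert i s)) := by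
        gcongr
    _ = ∑ a ∈ G.powerset, ∑ b ∈ G.powerset, 0.7 * (m' a * gg (m' b) (m' (insert i b)) +
          m' b * gg (m' a) (m' (insert i a))) := by
        simp only [← Finset.mul_sum, Finset.sum_add_distrib]
        rw [← Finset.sum_mul]
        simp only [← Finset.sum_mul]
        rw [← Finset.mul_sum]
        ring
    _ ≤ ∑ a ∈ G.powerset, ∑ b ∈ G.powerset, gg (m' a * m' b) (m' a * m' (insert i b) +
          m' (insert i a) * m' b + m' (insert i a) * m' (insert i b)) :=
        Finset.sum_le_sum fun a _ => Finset.sum_le_sum fun b _ =>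
          gg_key (hm _) (hm _) (hm _) (hm _)
    _ = ∑ s ∈ G.powerset, ∑ p ∈ G.powerset ×ˢ G.powerset,
          gg (if p.1 ∪ p.2 = s then m' p.1 * m' p.2 else 0)
           (if p.1 ∪ p.2 = s then m' p.1 * m' (insert i p.2) + m' (insert i p.1) * m' p.2
              + m' (insert i p.1) * m' (insert i p.2) else 0) := by
        rw [Finset.sum_comm (s := G.powerset) (t := G.powerset ×ˢ G.powerset),
          Finset.sum_product]
        refine Finset.sum_congr rfl fun a ha => Finset.sum_congr rfl fun b hb => ?_
        rw [Finset.mem_powerset] at ha hb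
        rw [Finset.sum_eq_single (a ∪ b)]
        · simp
        · intro s _ hs
          simp [hs.symm, gg_zero]
        · intro hh
          exact absurd (Finset.mem_powerset.2 (Finset.union_subset ha hb)) hh
    _ ≤ _ := by
        refine Finset.sum_le_sum fun s hs => ?_
        rw [Finset.mem_powerset] at hs
        rw [ww_succ0 _ _ _ hi _ hs, ww_succ1 _ _ _ hi _ hs, ← Finset.sum_product',
          ← Finset.sum_product']
        refine gg_sum _ _ _ ?_ ?_
        · intro p
          split_ifs
          · exact mul_nonneg (hm _) (hm _)
          · exact le_rfl
        · intro p
          split_ifs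
          · exact add_nonneg (add_nonneg (mul_nonneg (hm _) (hm _)) (mul_nonneg (hm _) (hm _)))
              (mul_nonneg (hm _) (hm _))
          · exact le_rfl

noncomputable def mm (F : Finset (Finset ℕ)) (i : ℕ) (s : Finset ℕ) : ℝ :=
  ((F.filter (fun A => A ∩ Finset.range i = s)).card : ℝ)

lemma mm_split (F : Finset (Finset ℕ)) (i : ℕ) (s : Finset ℕ) (hs : s ⊆ Finset.range i) :
    mm F i s = mm F (i+1) s + mm F (i+1) (insert i s) := by
  have his : i ∉ s := fun h => by simpa using hs h
  unfold mm
  rw [← Nat.cast_add, ← Finset.card_union_of_disjoint]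
  · congr 2
    ext A
    simp only [Finset.mem_filter, Finset.mem_union]
    rw [← and_or_left]
    refine and_congr_right fun _ => ?_
    rw [Finset.range_add_one]
    have hi' : i ∉ A ∩ Finset.range i := by simp
    by_cases hA : i ∈ A
    · rw [Finset.inter_insert_of_mem hA]
      constructor
      · intro h; right; rw [h]
      · rintro (h | h)
        · exact absurd (h ▸ Finset.mem_insert_self _ _) his
        · rw [← Finset.erase_insert hi', h, Finset.erase_insert his]
    · rw [Finset.inter_insert_of_notMem hA]
      constructor
      · intro h; left; exact h
      · rintro (h | h)
        · exact h
        · exact absurd (h ▸ Finset.mem_insert_self i s) hi'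
  · rw [Finset.disjoint_left]
    intro A hA hA'
    simp only [Finset.mem_filter] at hA hA'
    apply his
    rw [← hA.2, hA'.2]
    simp

lemma mm_sum (F : Finset (Finset ℕ)) (i : ℕ) :
    ∑ s ∈ (Finset.range i).powerset, mm F (i+1) s = ((F.filter (fun A => i ∉ A)).card : ℝ) := by
  unfold mm
  rw [← Nat.cast_sum]
  congr 1
  rw [Finset.card_eq_sum_card_fiberwise (f := fun A => A ∩ Finset.range (i+1))
    (t := (Finset.range i).powerset)]
  · refine Finset.sum_congr rfl fun s hs => ?_
    congr 1
    ext A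
    simp only [Finset.mem_filter]
    constructor
    · rintro ⟨h1, h2⟩
      refine ⟨⟨h1, fun h => ?_⟩, h2⟩
      have : i ∈ s := by rw [← h2]; simp [h]
      have := Finset.mem_powerset.1 hs this
      simp at this
    · rintro ⟨⟨h1, _⟩, h2⟩
      exact ⟨h1, h2⟩
  · intro A hA
    simp only [Finset.coe_filter, Set.mem_ofPred_eq] at hA
    simp only [Finset.coe_powerset, Set.mem_preimage, Set.mem_powerset_iff]
    intro x hx
    simp at hx ⊢
    rcases hx with ⟨h1, h2⟩
    have : x ≠ i := fun h => hA.2 (h ▸ h1)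
    omega

lemma mm_top (F : Finset (Finset ℕ)) (N : ℕ) (hN : ∀ A ∈ F, A ⊆ Finset.range N) (s : Finset ℕ) :
    mm F N s = if s ∈ F then 1 else 0 := by
  unfold mm
  have : F.filter (fun A => A ∩ Finset.range N = s) = F.filter (fun A => A = s) := by
    refine Finset.filter_congr fun A hA => ?_
    rw [Finset.inter_eq_left.2 (hN A hA)]
  rw [this, Finset.filter_eq']
  split_ifs <;> simp

lemma main_quarter (F : Finset (Finset ℕ)) (hUC : UnionClosed F) (hne : F.Nonempty)
    (h : ∀ a, ((F.filter (fun S => a ∈ S)).card : ℝ) < 1/4 * F.card) : F.card ≤ 1 := by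
  obtain ⟨N, hN⟩ : ∃ N, ∀ A ∈ F, A ⊆ Finset.range N := by
    obtain ⟨N, hN⟩ := Finset.exists_nat_subset_range (F.sup id)
    exact ⟨N, fun A hA => (Finset.le_sup (f := id) hA).trans hN⟩
  set K : ℝ := (F.card : ℝ) with hK
  have hKpos : 0 < K := by rw [hK]; exact_mod_cast hne.card_pos
  have hstep : ∀ i : ℕ, 1.05 * K * (EE (mm F (i+1)) (Finset.range (i+1)) - EE (mm F i) (Finset.range i))
      ≤ EE (ww (mm F (i+1)) (Finset.range (i+1))) (Finset.range (i+1))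
        - EE (ww (mm F i) (Finset.range i)) (Finset.range i) := by
    intro i
    have := step (mm F i) (mm F (i+1)) (Finset.range i) i (by simp)
      (fun a => by unfold mm; positivity) (fun s hs => mm_split F i s hs) (3/4 * K) (by
        rw [mm_sum]
        have h1 := h i
        have h2 := Finset.card_filter_add_card_filter_not (s := F) (fun S => i ∈ S)
        have h3 : ((F.filter (fun S => i ∈ S)).card : ℝ) + ((F.filter (fun S => i ∉ S)).card : ℝ) = K := by
          rw [hK]; exact_mod_cast h2
        linarith)
    rw [← Finset.range_add_one] at this
    refine le_trans (le_of_eq ?_) this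
    ring
  have htel : 1.05 * K * (EE (mm F N) (Finset.range N) - EE (mm F 0) (Finset.range 0))
      ≤ EE (ww (mm F N) (Finset.range N)) (Finset.range N)
        - EE (ww (mm F 0) (Finset.range 0)) (Finset.range 0) := by
    have := Finset.sum_le_sum (s := Finset.range N) fun i _ => hstep i
    rw [← Finset.mul_sum, Finset.sum_range_sub (fun i => EE (mm F i) (Finset.range i)),
      Finset.sum_range_sub (fun i => EE (ww (mm F i) (Finset.range i)) (Finset.range i))] at this
    exact this
  have e1 : EE (mm F N) (Finset.range N) = 0 := by
    unfold EE
    refine Finset.sum_eq_zero fun s _ => ?_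
    rw [mm_top F N hN]
    split_ifs <;> simp
  have m0 : mm F 0 ∅ = K := by simp [mm, hK]
  have e2 : EE (mm F 0) (Finset.range 0) = - (K * Real.log K) := by
    simp [EE, m0, Real.negMulLog]
  have e3 : EE (ww (mm F 0) (Finset.range 0)) (Finset.range 0) = - (2 * K^2 * Real.log K) := by
    simp [EE, ww, m0, Real.negMulLog, Real.log_mul hKpos.ne' hKpos.ne']
    ring
  have hsub : F ⊆ (Finset.range N).powerset := fun A hA => Finset.mem_powerset.2 (hN A hA)
  have hw0 : ∀ s ∈ (Finset.range N).powerset, s ∉ F → ww (mm F N) (Finset.range N) s = 0 := by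
    intro s _ hs
    unfold ww
    refine Finset.sum_eq_zero fun a _ => Finset.sum_eq_zero fun b _ => ?_
    split_ifs with hab
    · rw [mm_top F N hN, mm_top F N hN]
      by_cases ha : a ∈ F
      · by_cases hb : b ∈ F
        · exact absurd (hab ▸ hUC a ha b hb) hs
        · simp [hb]
      · simp [ha]
    · rfl
  have htot : ∑ s ∈ F, ww (mm F N) (Finset.range N) s = K * K := by
    rw [Finset.sum_subset hsub hw0, ww_total]
    have : ∑ a ∈ (Finset.range N).powerset, mm F N a = K := by
      simp only [mm_top F N hN]
      rw [Finset.sum_ite_mem, Finset.inter_eq_right.2 hsub]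
      simp [hK]
    rw [this]
  have e4 : EE (ww (mm F N) (Finset.range N)) (Finset.range N) ≤ - (K^2 * Real.log K) := by
    unfold EE
    rw [← Finset.sum_subset hsub (fun s hs hs' => by rw [hw0 s hs hs']; simp)]
    have hj := Real.concaveOn_negMulLog.le_map_sum (t := F) (w := fun _ => 1 / K)
      (p := fun s => ww (mm F N) (Finset.range N) s) (fun _ _ => by positivity)
      (by simp [← hK]; field_simp)
      (fun s _ => ww_nonneg _ (fun a => by unfold mm; positivity) _ _)
    simp only [smul_eq_mul] at hj
    rw [← Finset.mul_sum, ← Finset.mul_sum, htot] at hj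
    have e : 1 / K * (K * K) = K := by field_simp
    rw [e] at hj
    have := mul_le_mul_of_nonneg_left hj hKpos.le
    rw [← mul_assoc, mul_one_div_cancel hKpos.ne', one_mul] at this
    refine this.trans (le_of_eq ?_)
    simp [Real.negMulLog]
    ring
  rw [e1, e2, e3] at htel
  by_contra hcon
  push Not at hcon
  have hK1 : 1 < K := by rw [hK]; exact_mod_cast hcon
  have hlog := Real.log_pos hK1
  have : 0 < K^2 * Real.log K := by positivity
  nlinarith

theorem stmt_8 (n : ℕ) (hn : 16 ≤ n) (F : Finset (Finset ℕ)) (hUC : UnionClosed F)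
    (hcard : (F.sup id).card = n) :
    ∃ a ∈ F.sup id, ((F.filter (fun S => a ∈ S)).card : ℝ) ≥
      (1 / 2) * Real.sqrt (Real.logb 2 (n : ℝ) / (n : ℝ)) * (F.card : ℝ) := by
  by_contra hcon
  push Not at hcon
  have hne : F.Nonempty := by
    rw [Finset.nonempty_iff_ne_empty]
    rintro rfl
    simp at hcard
    omega
  have hKpos : (0:ℝ) < F.card := by exact_mod_cast hne.card_pos
  have hlt : ∀ a, ((F.filter (fun S => a ∈ S)).card : ℝ) < 1/4 * F.card := by
    intro a
    by_cases ha : a ∈ F.sup id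
    · refine (hcon a ha).trans_le ?_
      exact mul_le_mul_of_nonneg_right (bound_bd n hn) hKpos.le
    · have : F.filter (fun S => a ∈ S) = ∅ := by
        rw [Finset.filter_eq_empty_iff]
        intro S hS haS
        exact ha (Finset.le_sup (f := id) hS haS)
      rw [this]
      simp
      exact hne
  have h1 := main_quarter F hUC hne hlt
  have h2 : F.card = 1 := le_antisymm h1 hne.card_pos
  obtain ⟨S, rfl⟩ := Finset.card_eq_one.1 h2
  simp at hcard
  have hS : S.Nonempty := by rw [← Finset.card_pos]; omega
  obtain ⟨a, ha⟩ := hS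
  have := hlt a
  rw [Finset.filter_singleton, if_pos ha] at this
  norm_num at this
end
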